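/- For every connected simple graph G, there exists an assignment of nonempty subsets of {1,2,3} to the edges of G such that for each color j the set of edges whose label contains j induces a subgraph with all non-isolated vertices of odd degree, and at most one edge receives a label of size greater than 1, that label having size exactly 2. Equivalently, min ovl(G) ≤ 2. -/

import Mathlib

namespace OddCover

set_option linter.unusedSectionVars false

variable {V : Type*} [DecidableEq V]

/-- Cut formulation of connectedness of the subgraph induced on a finite set of vertices. -/
def Conn (G : SimpleGraph V) (S : Finset V) : Prop :=
  ∀ A ⊆ S, A.Nonempty → A ≠ S → ∃ a ∈ A, ∃ b ∈ S, b ∉ A ∧ G.Adj a b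

/-- All edges of `G` inside `S` that leave `A` end in `u`. -/
def Attached (G : SimpleGraph V) (S : Finset V) (u : V) (A : Finset V) : Prop :=
  A ⊆ S ∧ A.Nonempty ∧ u ∈ S ∧ u ∉ A ∧ ∀ a ∈ A, ∀ b ∈ S, b ∉ A → G.Adj a b → b = u

/-- Zero or odd. -/
def ZOdd (n : ℕ) : Prop := n = 0 ∨ n % 2 = 1

variable {G : SimpleGraph V}

lemma Conn.empty : Conn G ∅ := fun A hA hne _ => by
  rw [Finset.subset_empty.1 hA] at hne; simp at hne

lemma Conn.insert {S : Finset V} (hS : Conn G S) {v t : V} (ht : t ∈ S) (hvt : G.Adj v t) :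
    Conn G (insert v S) := by
  intro A hA hne hAS
  by_cases hv : v ∈ A
  · by_cases htA : t ∈ A
    · have h1 : A ∩ S ≠ S := by
        intro h
        apply hAS
        apply Finset.Subset.antisymm hA
        intro x hx
        rcases Finset.mem_insert.1 hx with rfl | hx
        · exact hv
        · rw [← h] at hx; exact (Finset.mem_inter.1 hx).1
      obtain ⟨a, ha, b, hb, hbA, hab⟩ := hS (A ∩ S) Finset.inter_subset_right
        ⟨t, Finset.mem_inter.2 ⟨htA, ht⟩⟩ h1
      grind
    · exact ⟨v, hv, t, Finset.mem_insert_of_mem ht, htA, hvt⟩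
  · have hAsub : A ⊆ S := by grind
    by_cases h : A = S
    · exact ⟨t, h ▸ ht, v, Finset.mem_insert_self _ _, hv, hvt.symm⟩
    · obtain ⟨a, ha, b, hb, hbA, hab⟩ := hS A hAsub hne h
      exact ⟨a, ha, b, Finset.mem_insert_of_mem hb, hbA, hab⟩

lemma Conn.exists_adj {S : Finset V} (hS : Conn G S) {v : V} (hv : v ∈ S) (hc : 2 ≤ S.card) :
    ∃ t ∈ S, G.Adj v t := by
  obtain ⟨a, ha, b, hb, -, hab⟩ := hS {v} (by simpa using hv) ⟨v, by simp⟩ (by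
    rintro rfl; simp at hc)
  rw [Finset.mem_singleton] at ha
  exact ⟨b, hb, ha ▸ hab⟩

lemma not_conn {S : Finset V} (h : ¬ Conn G S) (u : V) :
    ∃ A ⊆ S, A.Nonempty ∧ u ∉ A ∧ A ≠ S ∧ ∀ a ∈ A, ∀ b ∈ S, b ∉ A → ¬ G.Adj a b := by
  simp only [Conn, not_forall] at h
  obtain ⟨A, hA, hne, hAS, h⟩ := h
  push Not at h
  by_cases hu : u ∈ A
  · refine ⟨S \ A, Finset.sdiff_subset, ?_, by simp [hu], ?_, ?_⟩
    · rw [Finset.sdiff_nonempty]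
      exact fun h' => hAS (Finset.Subset.antisymm hA h')
    · intro h'
      obtain ⟨x, hx⟩ := hne
      have : x ∈ S \ A := by rw [h']; exact hA hx
      simp [hx] at this
    · intro a ha b hb hbA hab
      simp only [Finset.mem_sdiff, not_and, not_not] at ha hbA
      exact h b (hbA hb) a ha.1 ha.2 hab.symm
  · exact ⟨A, hA, hne, hu, hAS, h⟩

lemma Attached.conn_sdiff {S A : Finset V} {u : V} (hS : Conn G S) (h : Attached G S u A) :
    Conn G (S \ A) := by
  by_contra hc
  obtain ⟨B, hB, hne, huB, -, hcl⟩ := not_conn hc u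
  obtain ⟨hAS, hAne, hu, huA, hA⟩ := h
  obtain ⟨a, ha, b, hb, hbB, hab⟩ := hS B (by grind) hne (by grind)
  have := hcl a ha b
  have := hA b
  have := hab.symm
  grind

lemma Attached.exists_end {S : Finset V} (hS : Conn G S) {u₀ : V} {A₀ : Finset V}
    (h₀ : Attached G S u₀ A₀) :
    ∃ u A, A ⊆ A₀ ∧ Attached G S u A ∧ Conn G A ∧ ∀ y ∈ A, Conn G (S.erase y) := by
  induction hn : A₀.card using Nat.strong_induction_on generalizing u₀ A₀ with
  | _ n ih =>
  subst hn
  by_cases hA : Conn G A₀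
  · by_cases hy : ∀ y ∈ A₀, Conn G (S.erase y)
    · exact ⟨u₀, A₀, Finset.Subset.refl _, h₀, hA, hy⟩
    · push Not at hy
      obtain ⟨y, hyA, hy⟩ := hy
      obtain ⟨B, hB, hne, huB, -, hcl⟩ := not_conn hy u₀
      obtain ⟨hAS, hAne, hu, huA, hA'⟩ := h₀
      have hBA : B ⊆ A₀ := by
        by_contra hBA
        have hne' : (B \ A₀).Nonempty := Finset.sdiff_nonempty.2 hBA
        obtain ⟨a, ha, b, hb, hbB, hab⟩ := hS (B \ A₀) (by grind) hne' (by grind)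
        have := hcl a (Finset.mem_sdiff.1 ha).1 b
        have := hA' b
        have := hab.symm
        grind
      have hlt : B ⊂ A₀ := by
        refine ⟨hBA, fun h => ?_⟩
        have := hB (h hyA)
        simp at this
      have hatt : Attached G S y B := by
        refine ⟨by grind, hne, hAS hyA, fun h => ?_, ?_⟩
        · have := hB h
          simp at this
        · intro a ha b hb hbB hab
          by_contra hby
          exact hcl a ha b (Finset.mem_erase.2 ⟨hby, hb⟩) hbB hab
      obtain ⟨u, A, h1, h2⟩ := ih _ (Finset.card_lt_card hlt) hatt rfl
      exact ⟨u, A, h1.trans hBA, h2⟩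
  · obtain ⟨B, hB, hne, -, hBne, hcl⟩ := not_conn hA u₀
    obtain ⟨hAS, hAne, hu, huA, hA'⟩ := h₀
    have hatt : Attached G S u₀ B := by
      refine ⟨hB.trans hAS, hne, hu, fun h => huA (hB h), ?_⟩
      intro a ha b hb hbB hab
      have := hcl a ha b
      have := hA' a (hB ha) b
      grind
    obtain ⟨u, A, h1, h2⟩ := ih _ (Finset.card_lt_card (hB.ssubset_of_ne hBne)) hatt rfl
    exact ⟨u, A, h1.trans hB, h2⟩

lemma Conn.attached_erase {S : Finset V} {u : V} (hu : u ∈ S) (hc : 2 ≤ S.card) :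
    Attached G S u (S.erase u) := by
  refine ⟨Finset.erase_subset _ _, ?_, hu, by simp, by grind⟩
  rw [← Finset.card_pos, Finset.card_erase_of_mem hu]; omega

lemma Conn.exists_erase {S : Finset V} (hS : Conn G S) (hne : S.Nonempty) :
    ∃ y ∈ S, Conn G (S.erase y) := by
  obtain ⟨u, hu⟩ := hne
  by_cases hc : 2 ≤ S.card
  · obtain ⟨-, A, hA, ⟨-, ⟨y, hy⟩, -⟩, -, h⟩ := (Conn.attached_erase hu hc).exists_end hS
    exact ⟨y, Finset.mem_of_mem_erase (hA hy), h y hy⟩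
  · refine ⟨u, hu, ?_⟩
    have : S.erase u = ∅ := by
      rw [← Finset.card_eq_zero, Finset.card_erase_of_mem hu]; omega
    rw [this]; exact Conn.empty

variable [DecidableRel G.Adj]

variable (G) in
/-- The number of neighbours of `u` in `S`. -/
def deg (S : Finset V) (u : V) : ℕ := ∑ z ∈ S, if G.Adj u z then 1 else 0

variable (G) in
/-- The number of edges of colour `j` from `u` to `S`. -/
def cnt (S : Finset V) (χ : V → V → Fin 3) (j : Fin 3) (u : V) : ℕ :=
  ∑ z ∈ S, if G.Adj u z ∧ χ u z = j then 1 else 0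

lemma deg_eq_cnt (S : Finset V) (χ : V → V → Fin 3) (u : V) :
    deg G S u = cnt G S χ 0 u + cnt G S χ 1 u + cnt G S χ 2 u := by
  unfold deg cnt
  rw [← Finset.sum_add_distrib, ← Finset.sum_add_distrib]
  refine Finset.sum_congr rfl fun z _ => ?_
  by_cases h : G.Adj u z
  · simp only [h, true_and]
    generalize χ u z = c
    revert c; decide
  · simp [h]

lemma deg_insert {S : Finset V} {w : V} (hw : w ∉ S) (u : V) :
    deg G (insert w S) u = (if G.Adj u w then 1 else 0) + deg G S u :=
  Finset.sum_insert hw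

lemma deg_union {S T : Finset V} (h : Disjoint S T) (u : V) :
    deg G (S ∪ T) u = deg G S u + deg G T u :=
  Finset.sum_union h

lemma cnt_insert {S : Finset V} {w : V} (hw : w ∉ S) (χ : V → V → Fin 3) (j : Fin 3) (u : V) :
    cnt G (insert w S) χ j u = (if G.Adj u w ∧ χ u w = j then 1 else 0) + cnt G S χ j u :=
  Finset.sum_insert hw

lemma cnt_union {S T : Finset V} (h : Disjoint S T) (χ : V → V → Fin 3) (j : Fin 3) (u : V) :
    cnt G (S ∪ T) χ j u = cnt G S χ j u + cnt G T χ j u :=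
  Finset.sum_union h

lemma cnt_congr {S : Finset V} {χ χ' : V → V → Fin 3} {u : V} (h : ∀ z ∈ S, χ u z = χ' u z)
    (j : Fin 3) : cnt G S χ j u = cnt G S χ' j u :=
  Finset.sum_congr rfl fun z hz => by rw [h z hz]

lemma cnt_const {S : Finset V} {χ : V → V → Fin 3} {u : V} {i : Fin 3}
    (h : ∀ z ∈ S, χ u z = i) (j : Fin 3) : cnt G S χ j u = if i = j then deg G S u else 0 := by
  unfold cnt deg
  split_ifs with hij
  · exact Finset.sum_congr rfl fun z hz => by simp [h z hz, hij]
  · exact Finset.sum_eq_zero fun z hz => by simp [h z hz, hij]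

lemma sum_deg_comm (S T : Finset V) : ∑ u ∈ S, deg G T u = ∑ u ∈ T, deg G S u := by
  unfold deg
  rw [Finset.sum_comm]
  simp only [G.adj_comm]

lemma sum_deg_even (S : Finset V) : (∑ u ∈ S, deg G S u) % 2 = 0 := by
  induction S using Finset.induction_on with
  | empty => simp
  | insert w S hw ih =>
    have h1 : ∑ u ∈ insert w S, deg G (insert w S) u
        = deg G S w + (∑ u ∈ S, (if G.Adj u w then 1 else 0) + ∑ u ∈ S, deg G S u) := by
      rw [Finset.sum_insert hw, deg_insert hw, ← Finset.sum_add_distrib]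
      simp only [SimpleGraph.irrefl, if_false, zero_add]
      congr 1
      exact Finset.sum_congr rfl fun u _ => deg_insert hw u
    have h2 : ∑ u ∈ S, (if G.Adj u w then 1 else 0) = deg G S w := by
      simp only [deg, G.adj_comm]
    omega

lemma deg_pos {S : Finset V} {u t : V} (ht : t ∈ S) (h : G.Adj u t) : 0 < deg G S u := by
  have := Finset.single_le_sum (f := fun z => if G.Adj u z then 1 else 0)
    (fun _ _ => Nat.zero_le _) ht
  simp only [h, if_true] at this
  exact this

lemma sum_deg_parity {S : Finset V} (hodd : ∀ u ∈ S, deg G S u % 2 = 1) : S.card % 2 = 0 := by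
  have h := sum_deg_even (G := G) S
  rw [Finset.sum_nat_mod, Finset.sum_congr rfl hodd] at h
  simpa using h

/-- Extend a colouring by the edges at a new vertex. -/
def extend (w : V) (g : V → Fin 3) (χ : V → V → Fin 3) (a b : V) : Fin 3 :=
  if a = w then g b else if b = w then g a else χ a b

lemma extend_symm {w : V} {g : V → Fin 3} {χ : V → V → Fin 3} (h : ∀ a b, χ a b = χ b a) (a b : V) :
    extend w g χ a b = extend w g χ b a := by
  unfold extend
  split_ifs <;> simp_all

lemma cnt_extend_of_mem {S : Finset V} {w : V} (hw : w ∉ S) (g : V → Fin 3) (χ : V → V → Fin 3)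
    (j : Fin 3) {u : V} (hu : u ∈ S) :
    cnt G (insert w S) (extend w g χ) j u
      = (if G.Adj u w ∧ g u = j then 1 else 0) + cnt G S χ j u := by
  have huw : u ≠ w := by rintro rfl; exact hw hu
  rw [cnt_insert hw, cnt_congr (χ' := χ)]
  · simp [extend, huw]
  · intro z hz
    have : z ≠ w := by rintro rfl; exact hw hz
    simp [extend, huw, this]

lemma cnt_extend_self {S : Finset V} {w : V} (hw : w ∉ S) (g : V → Fin 3) (χ : V → V → Fin 3)
    (j : Fin 3) :
    cnt G (insert w S) (extend w g χ) j w = cnt G S (fun _ z => g z) j w := by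
  rw [cnt_insert hw]
  simp [cnt, extend]

lemma deg_erase {S : Finset V} {t : V} (ht : t ∈ S) (u : V) :
    deg G S u = (if G.Adj u t then 1 else 0) + deg G (S.erase t) u :=
  (Finset.add_sum_erase S _ ht).symm

lemma cnt_erase {S : Finset V} {t : V} (ht : t ∈ S) (χ : V → V → Fin 3) (j : Fin 3) (u : V) :
    cnt G S χ j u = (if G.Adj u t ∧ χ u t = j then 1 else 0) + cnt G (S.erase t) χ j u :=
  (Finset.add_sum_erase S _ ht).symm

lemma sum_adj (S : Finset V) (y : V) : (∑ u ∈ S, if G.Adj u y then 1 else 0) = deg G S y := by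
  simp only [deg, G.adj_comm]

lemma sum_adj_ne {S : Finset V} {t : V} (ht : t ∈ S) (y : V) :
    (∑ u ∈ S, if G.Adj u y ∧ u ≠ t then 1 else 0) = deg G (S.erase t) y := by
  rw [← Finset.add_sum_erase S _ ht, ← sum_adj]
  simp only [ne_eq, not_true_eq_false, and_false, if_false, zero_add]
  exact Finset.sum_congr rfl fun u hu => by simp [Finset.ne_of_mem_erase hu]

/-- On a connected vertex set, edges can be coloured so that colour `0` has a prescribed parity at
each vertex, while `m u` additional pendant edges at `u` are coloured from `{1, 2}` making these
two colours absent or odd everywhere. -/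
lemma exists_pendants (n : ℕ) : ∀ {S : Finset V}, S.card = n → Conn G S → ∀ r m : V → ℕ,
    (∑ u ∈ S, r u) % 2 = 0 →
    ∃ χ : V → V → Fin 3, (∀ a b, χ a b = χ b a) ∧ ∃ q₁ q₂ : V → ℕ, ∀ u ∈ S,
      (cnt G S χ 0 u + r u) % 2 = 0 ∧ q₁ u + q₂ u = m u ∧
      ZOdd (cnt G S χ 1 u + q₁ u) ∧ ZOdd (cnt G S χ 2 u + q₂ u) := by
  induction n with
  | zero =>
    intro S hn hS r m hr
    rw [Finset.card_eq_zero] at hn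
    subst hn
    exact ⟨fun _ _ => 0, fun _ _ => rfl, fun _ => 0, fun _ => 0, by simp⟩
  | succ n ih =>
    intro S hn hS r m hr
    obtain ⟨y, hy, hSy⟩ := hS.exists_erase (Finset.card_pos.1 (by omega))
    obtain ⟨S', hyS', rfl⟩ : ∃ S', y ∉ S' ∧ insert y S' = S :=
      ⟨S.erase y, by simp, Finset.insert_erase hy⟩
    rw [Finset.erase_insert hyS'] at hSy
    rw [Finset.card_insert_of_notMem hyS'] at hn
    rw [Finset.sum_insert hyS'] at hr
    have hne : ∀ u ∈ S', u ≠ y := fun u hu h => hyS' (h ▸ hu)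
    by_cases hpar : (deg G S' y + r y) % 2 = 0
    · obtain ⟨χ, hχ, q₁, q₂, hq⟩ := ih (by omega) hSy
        (fun u => r u + if G.Adj u y then 1 else 0) m (by
          rw [Finset.sum_add_distrib, sum_adj]; omega)
      obtain ⟨a, b, hab, ha, hb⟩ : ∃ a b, a + b = m y ∧ ZOdd a ∧ ZOdd b := by
        rcases Nat.mod_two_eq_zero_or_one (m y) with h | h
        · rcases Nat.eq_zero_or_pos (m y) with h0 | h0
          · exact ⟨0, 0, by omega, Or.inl rfl, Or.inl rfl⟩
          · exact ⟨1, m y - 1, by omega, Or.inr rfl, Or.inr (by omega)⟩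
        · exact ⟨m y, 0, by omega, Or.inr h, Or.inl rfl⟩
      refine ⟨extend y (fun _ => 0) χ, extend_symm hχ, fun u => if u = y then a else q₁ u,
        fun u => if u = y then b else q₂ u, fun u hu => ?_⟩
      rcases Finset.mem_insert.1 hu with rfl | hu
      · have hc : ∀ j, cnt G S' (fun _ _ => 0) j u = if 0 = j then deg G S' u else 0 :=
          cnt_const fun _ _ => rfl
        simp only [cnt_extend_self hyS', hc, if_true]
        simpa using ⟨hpar, hab, ha, hb⟩
      · obtain ⟨h1, h2, h3, h4⟩ := hq u hu
        simp only [cnt_extend_of_mem hyS' _ _ _ hu, hne u hu, if_false]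
        simp only [and_true, Fin.isValue, show ¬ ((0 : Fin 3) = 1) by decide,
          show ¬ ((0 : Fin 3) = 2) by decide, and_false, if_false, zero_add]
        exact ⟨by omega, h2, h3, h4⟩
    · obtain ⟨t, ht, hyt⟩ : ∃ t ∈ S', G.Adj y t := by
        rcases S'.eq_empty_or_nonempty with rfl | hS'
        · simp [deg] at hpar hr; omega
        · exact hS.exists_adj hy (by
            rw [Finset.card_insert_of_notMem hyS']; have := hS'.card_pos; omega)
            |>.imp fun t ⟨ht, h⟩ => ⟨by
              rcases Finset.mem_insert.1 ht with rfl | h'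
              · exact absurd h G.irrefl
              · exact h', h⟩
      have hdeg := deg_erase (G := G) ht y
      rw [if_pos hyt] at hdeg
      obtain ⟨χ, hχ, q₁, q₂, hq⟩ := ih (by omega) hSy
        (fun u => r u + if G.Adj u y ∧ u ≠ t then 1 else 0) (fun u => m u + if u = t then 1 else 0)
        (by rw [Finset.sum_add_distrib, sum_adj_ne ht]; omega)
      obtain ⟨k, p₁, p₂, hk, hp⟩ : ∃ (k : Fin 3) (p₁ p₂ : V → ℕ), k ≠ 0 ∧ ∀ u ∈ S',
          p₁ u + p₂ u = m u ∧ q₁ u = p₁ u + (if u = t ∧ k = 1 then 1 else 0) ∧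
          q₂ u = p₂ u + (if u = t ∧ k = 2 then 1 else 0) := by
        have h := (hq t ht).2.1
        simp only [if_true] at h
        by_cases h1 : q₁ t = 0
        · refine ⟨2, q₁, fun u => q₂ u - if u = t then 1 else 0, by decide, fun u hu => ?_⟩
          have h' := (hq u hu).2.1
          by_cases hut : u = t
          · subst hut; simp at h' ⊢; omega
          · simp [hut] at h' ⊢; omega
        · refine ⟨1, fun u => q₁ u - if u = t then 1 else 0, q₂, by decide, fun u hu => ?_⟩
          have h' := (hq u hu).2.1
          by_cases hut : u = t
          · subst hut; simp at h' ⊢; omega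
          · simp [hut] at h' ⊢; omega
      obtain ⟨a, b, hab, ha, hb⟩ : ∃ a b, a + b = m y ∧ ZOdd ((if k = 1 then 1 else 0) + a) ∧
          ZOdd ((if k = 2 then 1 else 0) + b) := by
        have hk' : k = 1 ∨ k = 2 := by clear hp; revert k; decide
        unfold ZOdd
        rcases hk' with rfl | rfl <;> rcases Nat.mod_two_eq_zero_or_one (m y) with h | h
        · exact ⟨m y, 0, by simp; omega⟩
        · exact ⟨0, m y, by simp; omega⟩
        · exact ⟨0, m y, by simp; omega⟩
        · exact ⟨m y, 0, by simp; omega⟩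
      refine ⟨extend y (fun u => if u = t then k else 0) χ, extend_symm hχ,
        fun u => if u = y then a else p₁ u, fun u => if u = y then b else p₂ u, fun u hu => ?_⟩
      rcases Finset.mem_insert.1 hu with rfl | hu
      · have hc : ∀ j, cnt G (S'.erase t) (fun _ z => if z = t then k else 0) j u =
            if 0 = j then deg G (S'.erase t) u else 0 := fun j => cnt_const (by
              intro z hz; simp [Finset.ne_of_mem_erase hz]) j
        simp only [cnt_extend_self hyS', cnt_erase ht, hc, if_true, hyt, true_and, hk, if_false]
        refine ⟨by simp; omega, hab, by simpa using ha, by simpa using hb⟩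
      · obtain ⟨h1, h2, h3, h4⟩ := hq u hu
        obtain ⟨h5, h6, h7⟩ := hp u hu
        simp only [cnt_extend_of_mem hyS' _ _ _ hu, hne u hu, if_false]
        by_cases hut : u = t
        · subst hut
          simp only [hyt.symm, true_and, if_true, hk, if_false] at h1 h6 h7 ⊢
          rw [h6] at h3; rw [h7] at h4
          refine ⟨by simpa using h1, h5, ?_, ?_⟩
          · convert h3 using 1; omega
          · convert h4 using 1; omega
        · simp only [hut, false_and, if_false, add_zero, ne_eq, not_false_eq_true,
            and_true] at h1 h6 h7 ⊢
          rw [h6] at h3; rw [h7] at h4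
          refine ⟨by omega, h5, by simpa using h3, by simpa using h4⟩

/-- `exists_pendants` for at most one pendant edge at each vertex. -/
lemma exists_coloring {S : Finset V} (hS : Conn G S) (r : V → ℕ) (P : V → Prop) [DecidablePred P]
    (hr : (∑ u ∈ S, r u) % 2 = 0) :
    ∃ χ : V → V → Fin 3, (∀ a b, χ a b = χ b a) ∧ ∃ c : V → Fin 3, (∀ u, c u ≠ 0) ∧ ∀ u ∈ S,
      (cnt G S χ 0 u + r u) % 2 = 0 ∧
      ∀ j, j ≠ 0 → ZOdd (cnt G S χ j u + if P u ∧ c u = j then 1 else 0) := by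
  obtain ⟨χ, hχ, q₁, q₂, hq⟩ := exists_pendants _ rfl hS r (fun u => if P u then 1 else 0) hr
  refine ⟨χ, hχ, fun u => if q₁ u = 0 then 2 else 1, fun u => ?_, fun u hu => ?_⟩
  · dsimp only; split_ifs <;> decide
  · obtain ⟨h1, h2, h3, h4⟩ := hq u hu
    refine ⟨h1, fun j hj => ?_⟩
    have hj' : j = 1 ∨ j = 2 := by revert j; decide
    by_cases hP : P u
    · simp only [hP, if_true, true_and] at h2 ⊢
      by_cases h0 : q₁ u = 0
      · have : q₂ u = 1 := by omega
        rw [this] at h4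
        rw [h0] at h3
        rcases hj' with rfl | rfl <;> simpa [h0]
      · have : q₂ u = 0 := by omega
        have h5 : q₁ u = 1 := by omega
        rw [this] at h4
        rw [h5] at h3
        rcases hj' with rfl | rfl <;> simpa [h0]
    · simp only [hP, if_false, false_and] at h2 ⊢
      rw [show q₁ u = 0 by omega] at h3
      rw [show q₂ u = 0 by omega] at h4
      rcases hj' with rfl | rfl <;> assumption

/-- `exists_coloring` for at most one pendant edge, of prescribed colour. -/
lemma exists_coloring_single {S : Finset V} (hS : Conn G S) (r : V → ℕ) (x : V) {k : Fin 3}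
    (hk : k ≠ 0) (hr : (∑ u ∈ S, r u) % 2 = 0) :
    ∃ χ : V → V → Fin 3, (∀ a b, χ a b = χ b a) ∧ ∀ u ∈ S,
      (cnt G S χ 0 u + r u) % 2 = 0 ∧
      ∀ j, j ≠ 0 → ZOdd (cnt G S χ j u + if u = x ∧ k = j then 1 else 0) := by
  obtain ⟨χ, hχ, c, hc, h⟩ := exists_coloring hS r (fun u => u = x) hr
  let σ : Equiv.Perm (Fin 3) := Equiv.swap (c x) k
  have hσ0 : σ 0 = 0 := Equiv.swap_apply_of_ne_of_ne (hc x).symm hk.symm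
  have hcnt : ∀ j u, cnt G S (fun a b => σ (χ a b)) j u = cnt G S χ (σ.symm j) u := by
    intro j u
    simp only [cnt, Equiv.eq_symm_apply]
  refine ⟨fun a b => σ (χ a b), fun a b => congrArg σ (hχ a b), fun u hu => ?_⟩
  obtain ⟨h1, h2⟩ := h u hu
  refine ⟨?_, fun j hj => ?_⟩
  · rw [hcnt, (Equiv.symm_apply_eq σ).2 hσ0.symm]; exact h1
  · have := h2 (σ.symm j) (by
      rw [ne_eq, Equiv.symm_apply_eq, hσ0]; exact hj)
    rw [hcnt]
    convert this using 3
    refine and_congr_right fun hux => ?_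
    rw [hux, Equiv.eq_symm_apply, Equiv.swap_apply_left]

variable (G) in
/-- `e u j` counts the edges at `u` receiving `j` as a second colour, and at most one edge does. -/
def AtMostOneExtra (S : Finset V) (χ : V → V → Fin 3) (e : V → Fin 3 → ℕ) : Prop :=
  (∀ u j, e u j = 0) ∨ ∃ p ∈ S, ∃ q ∈ S, ∃ k, G.Adj p q ∧ χ p q ≠ k ∧
    ∀ u j, e u j = if (u = p ∨ u = q) ∧ j = k then 1 else 0

variable (G) in
/-- The subgraph induced on `S` has an odd covering with at most one doubly covered edge. -/
def Good (S : Finset V) : Prop :=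
  ∃ (χ : V → V → Fin 3) (e : V → Fin 3 → ℕ), (∀ a b, χ a b = χ b a) ∧ AtMostOneExtra G S χ e ∧
    ∀ u ∈ S, ∀ j, ZOdd (cnt G S χ j u + e u j)

lemma Good.of_coloring {S : Finset V} {χ : V → V → Fin 3} (hχ : ∀ a b, χ a b = χ b a)
    (h : ∀ u ∈ S, ∀ j, ZOdd (cnt G S χ j u)) : Good G S :=
  ⟨χ, fun _ _ => 0, hχ, Or.inl fun _ _ => rfl, h⟩

lemma Good.of_extra {S : Finset V} {χ : V → V → Fin 3} (hχ : ∀ a b, χ a b = χ b a)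
    {p q : V} {k : Fin 3} (hp : p ∈ S) (hq : q ∈ S) (hpq : G.Adj p q) (hk : χ p q ≠ k)
    (h : ∀ u ∈ S, ∀ j, ZOdd (cnt G S χ j u + if (u = p ∨ u = q) ∧ j = k then 1 else 0)) :
    Good G S :=
  ⟨χ, fun u j => if (u = p ∨ u = q) ∧ j = k then 1 else 0, hχ,
    Or.inr ⟨p, hp, q, hq, k, hpq, hk, fun _ _ => rfl⟩, h⟩

lemma forall_fin_three {p : Fin 3 → Prop} : (∀ j, p j) ↔ p 0 ∧ p 1 ∧ p 2 := by
  constructor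
  · exact fun h => ⟨h 0, h 1, h 2⟩
  · rintro ⟨h0, h1, h2⟩ j
    fin_cases j <;> assumption

lemma Good.of_even {S : Finset V} (hS : Conn G S) (hc : S.card % 2 = 0) : Good G S := by
  obtain ⟨χ, hχ, c, -, h⟩ := exists_coloring hS (fun _ => 1) (fun _ => False) (by simpa using hc)
  refine Good.of_coloring hχ fun u hu j => ?_
  obtain ⟨h1, h2⟩ := h u hu
  by_cases hj : j = 0
  · subst hj; right; omega
  · simpa using h2 j hj

lemma Good.insert_leaf {S : Finset V} (hS : Conn G S) (hc : S.card % 2 = 0) {l : V} (hl : l ∉ S)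
    (hd : deg G S l = 1) : Good G (insert l S) := by
  obtain ⟨p, hp, hlp⟩ : ∃ p ∈ S, G.Adj l p := by
    by_contra hcon
    push Not at hcon
    have : deg G S l = 0 := Finset.sum_eq_zero fun z hz => by simp [hcon z hz]
    omega
  have huniq : ∀ u ∈ S, G.Adj u l ↔ u = p := by
    intro u hu
    refine ⟨fun h => ?_, fun h => h ▸ hlp.symm⟩
    by_contra hup
    have h1 := deg_erase (G := G) hp l
    have h2 := deg_pos (S := S.erase p) (Finset.mem_erase.2 ⟨hup, hu⟩) h.symm
    simp only [hlp, if_true] at h1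
    omega
  obtain ⟨χ, hχ, h⟩ := exists_coloring_single hS (fun _ => 1) p (k := 1) (by decide)
    (by simpa using hc)
  refine Good.of_coloring (extend_symm hχ (w := l) (g := fun _ => 1)) fun u hu j => ?_
  rcases Finset.mem_insert.1 hu with rfl | hu
  · rw [cnt_extend_self hl, cnt_const (i := 1) (fun _ _ => rfl), hd]
    unfold ZOdd
    split_ifs <;> simp
  · obtain ⟨h1, h2⟩ := h u hu
    rw [cnt_extend_of_mem hl _ _ _ hu]
    simp only [huniq u hu]
    by_cases hj : j = 0
    · subst hj; right; simp; omega
    · rw [add_comm]; exact h2 j hj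

lemma exists_color (n : Fin 3 → ℕ) (h0 : n 0 = 0) (h : (n 1 + n 2) % 2 = 1) :
    ∃ k, k ≠ 0 ∧ ∀ j, ZOdd ((if k = j then 1 else 0) + n j) := by
  simp only [forall_fin_three, ZOdd]
  rcases Nat.mod_two_eq_zero_or_one (n 1) with h1 | h1
  · exact ⟨1, by decide, by simp; omega⟩
  · exact ⟨2, by decide, by simp; omega⟩

lemma cnt_zero_of_ne {S : Finset V} {χ : V → V → Fin 3} {u : V} {j : Fin 3}
    (h : ∀ z ∈ S, G.Adj u z → χ u z ≠ j) : cnt G S χ j u = 0 :=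
  Finset.sum_eq_zero fun z hz => if_neg fun h' => h z hz h'.1 h'.2

/-- Removal of two adjacent even vertices. -/
lemma Good.insert_even_even {S : Finset V} (hS : Conn G S) {y w : V} (hy : y ∉ S)
    (hw : w ∉ insert y S) (hwy : G.Adj w y) (hdw : deg G (insert w (insert y S)) w % 2 = 0)
    (hdy : deg G (insert w (insert y S)) y % 2 = 0) (hc : S.card % 2 = 1) :
    Good G (insert w (insert y S)) := by
  rw [deg_insert hw, deg_insert hy] at hdw hdy
  simp only [SimpleGraph.irrefl, if_false, hwy, hwy.symm, if_true] at hdw hdy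
  obtain ⟨χ, hχ, c, hc0, h⟩ := exists_coloring hS (fun u => 1 + if G.Adj u y then 1 else 0)
    (fun u => G.Adj u w) (by rw [Finset.sum_add_distrib, sum_adj]; simp; omega)
  have hn := deg_eq_cnt (G := G) S (fun _ z => c z) w
  have hn0 : cnt G S (fun _ z => c z) 0 w = 0 := cnt_zero_of_ne fun z _ _ => hc0 z
  obtain ⟨k, hk, hkj⟩ := exists_color (fun j => cnt G S (fun _ z => c z) j w) hn0 (by
    omega)
  refine Good.of_coloring (extend_symm (w := w) (g := fun z => if z = y then k else c z)
    (extend_symm (w := y) (g := fun _ => 0) hχ)) fun u hu j => ?_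
  rcases Finset.mem_insert.1 hu with rfl | hu
  · rw [cnt_extend_self hw, cnt_insert hy]
    simp only [hwy, if_true, true_and]
    rw [cnt_congr (χ' := fun _ z => c z)]
    · exact hkj j
    · intro z hz
      have : z ≠ y := by rintro rfl; exact hy hz
      simp [this]
  · rw [cnt_extend_of_mem hw _ _ _ hu]
    rcases Finset.mem_insert.1 hu with rfl | hu
    · rw [cnt_extend_self hy, cnt_const (i := 0) (fun _ _ => rfl)]
      simp only [hwy.symm, if_true, true_and]
      unfold ZOdd
      by_cases hj : j = 0
      · subst hj; simp [hk]; omega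
      · simp [Ne.symm hj]; grind
    · have huy : u ≠ y := fun h => hy (h ▸ hu)
      rw [cnt_extend_of_mem hy _ _ _ hu]
      obtain ⟨h1, h2⟩ := h u hu
      simp only [huy, if_false]
      by_cases hj : j = 0
      · subst hj; right; simp [hc0]; omega
      · have := h2 j hj
        simp only [Ne.symm hj, and_false, if_false, zero_add]
        rwa [add_comm]

/-- The colouring used to remove an even vertex `w` and a vertex `y` not adjacent to it, having a
common neighbour `a` of odd degree. The edge `ya` gets colour `l`. -/
lemma exists_coloring_common_neighbor {S : Finset V} (hS : Conn G S) {y w a : V} (hy : y ∉ S)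
    (hw : w ∉ insert y S) (hwy : ¬ G.Adj w y) (ha : a ∈ S) (hwa : G.Adj w a) (hya : G.Adj y a)
    (hdw : deg G (insert w (insert y S)) w % 2 = 0)
    (hda : deg G (insert w (insert y S)) a % 2 = 1) (hc : S.card % 2 = 1) (k₀ : Prop) [Decidable k₀]
    (hr : (deg G S y + if k₀ then 1 else 0) % 2 = 1) :
    ∃ (n : Fin 3 → ℕ) (k : Fin 3), k ≠ 0 ∧ (n 0 + n 1 + n 2) % 2 = 1 ∧
      (n 0 + 1 + if k₀ then 0 else 1) % 2 = 0 ∧ ZOdd (n 1) ∧ ZOdd (n 2) ∧ ∀ l : Fin 3,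
      (¬ k₀ → l = 0) → ∃ χ : V → V → Fin 3, (∀ a b, χ a b = χ b a) ∧
        χ a y = l ∧
        (∀ u ∈ insert w (insert y S), u ≠ a → u ≠ y → ∀ j,
          ZOdd (cnt G (insert w (insert y S)) χ j u)) ∧
        (∀ j, cnt G (insert w (insert y S)) χ j a =
          (if k = j then 1 else 0) + (if l = j then 1 else 0) + n j) ∧
        (∀ j, cnt G (insert w (insert y S)) χ j y =
          (if l = j then 1 else 0) + (if 0 = j then deg G S y - 1 else 0)) := by
  have hwy' : ¬ G.Adj y w := fun h => hwy h.symm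
  have haw : a ≠ w := hwa.ne.symm
  have hay : a ≠ y := hya.ne.symm
  rw [deg_insert hw, deg_insert hy] at hdw hda
  simp only [SimpleGraph.irrefl, if_false, hwy, hwa.symm, hya.symm, if_true] at hdw hda
  have hdy' := deg_erase (G := G) ha y
  have hdw' := deg_erase (G := G) ha w
  simp only [hya, hwa, if_true] at hdy' hdw'
  obtain ⟨χ, hχ, c, hc0, h⟩ := exists_coloring hS
    (fun u => 1 + if G.Adj u y ∧ (k₀ → u ≠ a) then 1 else 0) (fun u => G.Adj u w ∧ u ≠ a) (by
      rw [Finset.sum_add_distrib]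
      by_cases hk₀ : k₀
      · simp only [hk₀, true_imp_iff, if_true] at hr ⊢
        rw [sum_adj_ne ha]; simp; omega
      · simp only [hk₀, false_imp_iff, if_false, and_true] at hr ⊢
        rw [sum_adj]; simp; omega)
  have hn := deg_eq_cnt (G := G) (S.erase a) (fun _ z => c z) w
  have hn0 : cnt G (S.erase a) (fun _ z => c z) 0 w = 0 := cnt_zero_of_ne fun z _ _ => hc0 z
  obtain ⟨k, hk, hkj⟩ := exists_color (fun j => cnt G (S.erase a) (fun _ z => c z) j w) hn0 (by
    omega)
  have hna := deg_eq_cnt (G := G) S χ a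
  obtain ⟨ha1, ha2⟩ := h a ha
  refine ⟨fun j => cnt G S χ j a, k, hk, by dsimp only; omega, ?_, by simpa using ha2 1 (by decide),
    by simpa using ha2 2 (by decide), fun l hl => ?_⟩
  · simp only [hya.symm, true_and] at ha1
    by_cases hk₀ : k₀ <;> simp [hk₀] at ha1 ⊢ <;> omega
  refine ⟨extend w (fun z => if z = a then k else c z)
    (extend y (fun z => if z = a then l else 0) χ),
    extend_symm (extend_symm hχ), ?_, fun u hu hua huy j => ?_, fun j => ?_, fun j => ?_⟩
  · have : y ≠ w := by rintro rfl; simp at hw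
    simp [extend, haw, hay, this]
  · rcases Finset.mem_insert.1 hu with rfl | hu
    · rw [cnt_extend_self hw, cnt_insert hy, cnt_erase ha]
      simp only [hwy, hwa, if_true, true_and, false_and, if_false, zero_add]
      rw [cnt_congr (χ' := fun _ z => c z)]
      · exact hkj j
      · intro z hz
        simp [Finset.ne_of_mem_erase hz]
    · have hu' : u ∈ S := (Finset.mem_insert.1 hu).resolve_left huy
      rw [cnt_extend_of_mem hw _ _ _ hu, cnt_extend_of_mem hy _ _ _ hu']
      obtain ⟨h1, h2⟩ := h u hu'
      simp only [hua, if_false, ne_eq, not_false_eq_true, and_true, implies_true] at h1 h2 ⊢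
      by_cases hj : j = 0
      · subst hj; right; simp [hc0]; omega
      · have := h2 j hj
        simp only [Ne.symm hj, and_false, if_false, zero_add]
        rwa [add_comm]
  · rw [cnt_extend_of_mem hw _ _ _ (Finset.mem_insert_of_mem ha), cnt_extend_of_mem hy _ _ _ ha]
    simp [hwa.symm, hya.symm, add_assoc]
  · rw [cnt_extend_of_mem hw _ _ _ (Finset.mem_insert_self _ _), cnt_extend_self hy, cnt_erase ha]
    rw [cnt_const (i := 0) (S := S.erase a)]
    · have : deg G (S.erase a) y = deg G S y - 1 := by omega
      simp [hwy', hya, this]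
    · intro z hz
      simp [Finset.ne_of_mem_erase hz]

/-- Removal of an even vertex `w` and a vertex `y` not adjacent to it, having a common neighbour
of odd degree. -/
lemma Good.insert_common_neighbor {S : Finset V} (hS : Conn G S) {y w a : V} (hy : y ∉ S)
    (hw : w ∉ insert y S) (hwy : ¬ G.Adj w y) (ha : a ∈ S) (hwa : G.Adj w a) (hya : G.Adj y a)
    (hdw : deg G (insert w (insert y S)) w % 2 = 0)
    (hda : deg G (insert w (insert y S)) a % 2 = 1) (hc : S.card % 2 = 1) :
    Good G (insert w (insert y S)) := by
  have hpos := deg_pos ha hya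
  by_cases hdy : deg G S y % 2 = 0
  · obtain ⟨n, k, hk, h1, h2, h3, h4, h⟩ := exists_coloring_common_neighbor hS hy hw hwy ha hwa hya
      hdw hda hc True (by simp; omega)
    obtain ⟨l, hl0, hl⟩ : ∃ l : Fin 3, l ≠ 0 ∧
        ∀ j, ZOdd ((if k = j then 1 else 0) + (if l = j then 1 else 0) + n j) := by
      simp only [forall_fin_three]
      unfold ZOdd at *
      have hk' : k = 1 ∨ k = 2 := by clear h; revert k; decide
      simp only [if_true] at h2
      by_cases hn : n 1 = 0
      · refine ⟨if k = 1 then 2 else 1, by split_ifs <;> decide, ?_⟩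
        rcases hk' with rfl | rfl <;> simp <;> omega
      · refine ⟨k, hk, ?_⟩
        rcases hk' with rfl | rfl <;> simp <;> omega
    obtain ⟨χ, hχ, -, h5, h6, h7⟩ := h l (by simp)
    refine Good.of_coloring hχ fun u hu j => ?_
    by_cases hua : u = a
    · subst hua; rw [h6]; exact hl j
    by_cases huy : u = y
    · subst huy; rw [h7]
      unfold ZOdd
      by_cases hj : j = 0
      · subst hj; simp [hl0]; omega
      · simp [Ne.symm hj]; grind
    exact h5 u hu hua huy j
  · obtain ⟨n, k, hk, h1, h2, h3, h4, h⟩ := exists_coloring_common_neighbor hS hy hw hwy ha hwa hya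
      hdw hda hc False (by simp; omega)
    obtain ⟨χ, hχ, hl, h5, h6, h7⟩ := h 0 (by simp)
    have hk' : k = 1 ∨ k = 2 := by clear h h5 h6 h7; revert k; decide
    simp only [if_false] at h2
    by_cases hn : n k = 0
    · refine Good.of_coloring hχ fun u hu j => ?_
      by_cases hua : u = a
      · subst hua; rw [h6]
        revert j
        simp only [forall_fin_three]
        unfold ZOdd at *
        rcases hk' with rfl | rfl <;> simp <;> omega
      by_cases huy : u = y
      · subst huy; rw [h7]
        unfold ZOdd
        by_cases hj : j = 0
        · subst hj; simp; omega
        · simp [Ne.symm hj]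
      exact h5 u hu hua huy j
    · refine Good.of_extra hχ (p := a) (q := y) (k := k) (by simp [ha]) (by simp) hya.symm
        (by rw [hl]; exact hk.symm) fun u hu j => ?_
      by_cases hua : u = a
      · subst hua; rw [h6]
        revert j
        simp only [forall_fin_three]
        unfold ZOdd at *
        rcases hk' with rfl | rfl <;> simp <;> omega
      by_cases huy : u = y
      · subst huy; rw [h7]
        unfold ZOdd
        by_cases hj : j = 0
        · subst hj; simp [hk.symm]; omega
        · simp [Ne.symm hj]; grind
      simpa [hua, huy] using h5 u hu hua huy j

lemma Good.union {T A : Finset V} (hd : Disjoint T A) {χ χ' : V → V → Fin 3} {e : V → Fin 3 → ℕ}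
    (hχ' : ∀ a b, χ' a b = χ' b a) (he : AtMostOneExtra G T χ e)
    (h : ∀ u ∈ T, ∀ j, ZOdd (cnt G T χ j u + e u j)) (hT : ∀ a ∈ T, ∀ b ∈ T, χ' a b = χ a b)
    (hcross : ∀ u ∈ T, ∀ j, cnt G A χ' j u % 2 = 0 ∧ (cnt G A χ' j u ≠ 0 → cnt G T χ j u ≠ 0))
    (hA : ∀ u ∈ A, ∀ j, ZOdd (cnt G (T ∪ A) χ' j u)) : Good G (T ∪ A) := by
  have heA : ∀ u ∈ A, ∀ j, e u j = 0 := by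
    intro u hu j
    have huT : u ∉ T := Finset.disjoint_right.1 hd hu
    rcases he with h | ⟨p, hp, q, hq, k, -, -, h⟩
    · exact h u j
    · rw [h, if_neg]
      rintro ⟨rfl | rfl, -⟩ <;> contradiction
  refine ⟨χ', e, hχ', ?_, fun u hu j => ?_⟩
  · rcases he with h | ⟨p, hp, q, hq, k, hpq, hk, h⟩
    · exact Or.inl h
    · exact Or.inr ⟨p, Finset.mem_union_left _ hp, q, Finset.mem_union_left _ hq, k, hpq,
        by rwa [hT p hp q hq], h⟩
  · rcases Finset.mem_union.1 hu with hu | hu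
    · obtain ⟨h1, h2⟩ := hcross u hu j
      have h3 := h u hu j
      rw [cnt_union hd, cnt_congr (hT u hu)]
      unfold ZOdd at *
      omega
    · rw [heA u hu]; exact hA u hu j

/-- Attaching a set of odd vertices using a single colour. -/
lemma Good.union_const {T A : Finset V} (hd : Disjoint T A) {χ : V → V → Fin 3} {e : V → Fin 3 → ℕ}
    (hχ : ∀ a b, χ a b = χ b a) (he : AtMostOneExtra G T χ e)
    (h : ∀ u ∈ T, ∀ j, ZOdd (cnt G T χ j u + e u j)) (i : Fin 3)
    (hcross : ∀ u ∈ T, deg G A u % 2 = 0 ∧ (deg G A u ≠ 0 → cnt G T χ i u ≠ 0))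
    (hA : ∀ u ∈ A, deg G (T ∪ A) u % 2 = 1) : Good G (T ∪ A) := by
  refine Good.union (χ' := fun a b => if a ∈ A ∨ b ∈ A then i else χ a b) hd (fun a b => ?_) he h
    (fun a ha b hb => ?_) (fun u hu j => ?_) (fun u hu j => ?_)
  · simp only [or_comm, hχ a b]
  · simp [Finset.disjoint_left.1 hd ha, Finset.disjoint_left.1 hd hb]
  · rw [cnt_const (i := i) (fun z hz => by simp [hz])]
    obtain ⟨h1, h2⟩ := hcross u hu
    by_cases hij : i = j
    · subst hij; simpa using ⟨h1, h2⟩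
    · simp [hij]
  · rw [cnt_const (i := i) (fun z hz => by simp [hu])]
    unfold ZOdd
    have := hA u hu
    split_ifs <;> omega

/-- The case of an even vertex `w` with an odd neighbour `v` all of whose other neighbours lie in a
set of odd vertices and are adjacent to `w`. -/
lemma Good.insert_dominating {A B : Finset V} {v w : V} (hd : Disjoint A B) (hv : v ∉ A ∪ B)
    (hw : w ∉ insert v (A ∪ B)) (hB : Conn G B) (hwv : G.Adj w v)
    (hN : ∀ z ∈ A ∪ B, G.Adj v z → z ∈ A ∧ G.Adj w z)
    (hA : ∀ a ∈ A, deg G (insert w (insert v (A ∪ B))) a % 2 = 1)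
    (hdv : deg G (insert w (insert v (A ∪ B))) v % 2 = 1)
    (hdw : deg G (insert w (insert v (A ∪ B))) w % 2 = 0) (hc : (A ∪ B).card % 2 = 1) :
    Good G (insert w (insert v (A ∪ B))) := by
  simp only [deg_insert hw, deg_insert hv, deg_union hd] at hA hdv hdw
  simp only [hwv, hwv.symm, if_true, SimpleGraph.irrefl, if_false] at hdv hdw
  have hvB : deg G B v = 0 := Finset.sum_eq_zero fun z hz => if_neg fun h =>
    Finset.disjoint_right.1 hd hz (hN z (Finset.mem_union_right _ hz) h).1
  have hsum : (∑ u ∈ B, ((1 + if G.Adj u w then 1 else 0) + deg G A u)) % 2 = 0 := by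
    have h1 : (∑ u ∈ A, ((if G.Adj u w then 1 else 0) + ((if G.Adj u v then 1 else 0) +
        (deg G A u + deg G B u)))) % 2 = A.card % 2 := by
      rw [Finset.sum_nat_mod, Finset.sum_congr rfl hA]; simp
    simp only [Finset.sum_add_distrib, sum_adj] at h1 ⊢
    have h2 := sum_deg_even (G := G) A
    have h3 := sum_deg_comm (G := G) A B
    have h4 := Finset.card_union_of_disjoint hd
    simp only [Finset.sum_const, smul_eq_mul, mul_one]
    omega
  obtain ⟨g, hg⟩ : ∃ g : V → Fin 3, ∀ z, g z = if G.Adj v z then 2 else 0 := ⟨_, fun _ => rfl⟩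
  have hw1 : cnt G (A ∪ B) (fun _ z => g z) 1 w = 0 :=
    cnt_zero_of_ne fun z _ _ => by simp only [hg]; split_ifs <;> decide
  have hw2 : cnt G (A ∪ B) (fun _ z => g z) 2 w = deg G (A ∪ B) v := by
    refine Finset.sum_congr rfl fun z hz => ?_
    have := hN z hz
    by_cases h : G.Adj v z
    · simp [hg, h, this h]
    · simp [hg, h]
  have hwd := deg_eq_cnt (G := G) (A ∪ B) (fun _ z => g z) w
  rw [deg_union hd] at hwd hw2
  have hw0 : cnt G (A ∪ B) (fun _ z => g z) 0 w % 2 = 1 := by omega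
  obtain ⟨x, hx, hwx, hvx⟩ : ∃ x ∈ A ∪ B, G.Adj w x ∧ ¬ G.Adj v x := by
    by_contra hcon
    push Not at hcon
    rw [cnt_zero_of_ne] at hw0
    · simp at hw0
    · intro z hz hz'
      simp [hg, hcon z hz hz']
  have hxv : x ≠ v := fun h => hv (h ▸ hx)
  obtain ⟨χ, hχ, h⟩ := exists_coloring_single hB _ x (k := 2) (by decide) hsum
  have hwv' : w ≠ v := hwv.ne
  have hwx' : w ≠ x := hwx.ne
  refine Good.of_extra (p := w) (q := x) (k := 2)
    (χ := extend w (fun z => if z = v then 1 else g z) (extend v (fun _ => 1)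
      (fun a b => if a ∈ A ∨ b ∈ A then 0 else χ a b)))
    (extend_symm (extend_symm fun a b => by simp only [or_comm, hχ a b])) (by simp)
    (Finset.mem_insert_of_mem (Finset.mem_insert_of_mem hx)) hwx
    (by simp [extend, hg, hvx, hxv]) fun u hu j => ?_
  rcases Finset.mem_insert.1 hu with rfl | hu
  · rw [cnt_extend_self hw, cnt_insert hv, cnt_congr (S := A ∪ B) (χ' := fun _ z => g z)]
    · revert j
      simp only [forall_fin_three, hw1, hw2, hwv, ZOdd]
      simp
      omega
    · intro z hz
      simp [show z ≠ v from fun h => hv (h ▸ hz)]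
  have huw : u ≠ w := fun h => hw (h ▸ hu)
  rw [cnt_extend_of_mem hw _ _ _ hu]
  rcases Finset.mem_insert.1 hu with rfl | hu
  · rw [cnt_extend_self hv, cnt_const (i := 1) (fun _ _ => rfl), deg_union hd]
    revert j
    simp only [forall_fin_three, ZOdd, hwv.symm, huw, Ne.symm hxv]
    simp
    omega
  have huv : u ≠ v := fun h => hv (h ▸ hu)
  rw [cnt_extend_of_mem hv _ _ _ hu]
  simp only [huw, huv, if_false, false_or]
  by_cases huA : u ∈ A
  · rw [cnt_const (i := 0) (fun _ _ => by simp [huA]), deg_union hd]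
    have h1 := hA u huA
    by_cases hvu : G.Adj v u
    · have hux : u ≠ x := by rintro rfl; exact hvx hvu
      have hwu := (hN u hu hvu).2
      simp only [hvu.symm, hwu.symm, if_true] at h1
      revert j
      simp only [forall_fin_three, ZOdd, hg, hvu.symm, hvu, hwu.symm, hux]
      simp
      omega
    · have hvu' : ¬ G.Adj u v := fun h => hvu h.symm
      simp only [hvu', if_false] at h1
      revert j
      simp only [forall_fin_three, ZOdd, hg, hvu, hvu']
      simp
      exact ⟨by omega, by grind⟩
  · have huB := (Finset.mem_union.1 hu).resolve_left huA
    have hvu : ¬ G.Adj v u := fun h => huA (hN u hu h).1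
    have hvu' : ¬ G.Adj u v := fun h => hvu h.symm
    rw [cnt_union hd, cnt_const (S := A) (i := 0) (fun z hz => by simp [hz]),
      cnt_congr (S := B) (χ' := χ)
      (fun z hz => by simp [huA, Finset.disjoint_right.1 hd hz])]
    obtain ⟨h1, h2⟩ := h u huB
    by_cases hj : j = 0
    · subst hj
      simp only [hg, hvu, hvu']
      right
      simp
      omega
    · have h3 := h2 j hj
      simp only [hg, hvu, hvu', false_and, if_false, Ne.symm hj, and_false, zero_add]
      simpa only [eq_comm (a := j)] using h3

/-- The case of an even vertex `w` whose neighbours are odd vertices having exactly one further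
common neighbour `u` outside. -/
lemma Good.insert_double_apex {A B : Finset V} {u w : V} (hd : Disjoint A B)
    (hw : w ∉ A ∪ B) (hB : Conn G B) (hcB : B.card % 2 = 0) (hu : u ∈ B)
    (hwA : ∀ a ∈ A, G.Adj w a) (hwB : ∀ b ∈ B, ¬ G.Adj w b)
    (hAB : ∀ a ∈ A, ∀ b ∈ B, G.Adj a b ↔ b = u) (hA : ∀ a ∈ A, deg G A a % 2 = 1)
    (hne : A.Nonempty) : Good G (insert w (A ∪ B)) := by
  obtain ⟨a₀, ha₀⟩ := hne
  have hcA := sum_deg_parity hA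
  have hposA := Finset.card_pos.2 ⟨a₀, ha₀⟩
  have hdisj : ∀ {a}, a ∈ A → a ∉ B := @(Finset.disjoint_left.1 hd)
  have hdisj' : ∀ {a}, a ∈ B → a ∉ A := @(Finset.disjoint_right.1 hd)
  obtain ⟨χ, hχ, h⟩ := exists_coloring_single hB (fun _ => 1) u (k := 1) (by decide)
    (by simpa using hcB)
  have huA := hdisj' hu
  have ha₀B := hdisj ha₀
  refine Good.of_extra (p := u) (q := a₀) (k := 1)
    (χ := extend w (fun z => if z = a₀ then 1 else 2)
      (fun a b => if a ∈ A ∧ b ∈ A then 1 else if a ∈ A ∨ b ∈ A then 0 else χ a b))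
    (extend_symm fun a b => by simp only [or_comm, and_comm, hχ a b]) (by simp [hu])
    (by simp [ha₀]) ((hAB a₀ ha₀ u hu).2 rfl).symm ?_ fun v hv j => ?_
  · have h1 : u ≠ w := by rintro rfl; simp [hu] at hw
    have h2 : a₀ ≠ w := by rintro rfl; simp [ha₀] at hw
    simp [extend, h1, h2, huA, ha₀]
  have hau : a₀ ≠ u := by rintro rfl; exact huA ha₀
  rcases Finset.mem_insert.1 hv with rfl | hv
  · have h1 : v ≠ u := by rintro rfl; simp [hu] at hw
    have h2 : v ≠ a₀ := by rintro rfl; simp [ha₀] at hw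
    rw [cnt_extend_self hw, cnt_union hd, cnt_zero_of_ne (S := B)
      (fun z hz hvz => absurd hvz (hwB z hz)), cnt_erase ha₀, cnt_const (S := A.erase a₀) (i := 2)
      (fun z hz => by simp [Finset.ne_of_mem_erase hz])]
    have h3 : deg G (A.erase a₀) v = A.card - 1 := by
      rw [← Finset.card_erase_of_mem ha₀, Finset.card_eq_sum_ones]
      exact Finset.sum_congr rfl fun z hz => by simp [hwA z (Finset.mem_of_mem_erase hz)]
    simp only [h1, h2, h3, hwA a₀ ha₀]
    revert j
    simp only [forall_fin_three, ZOdd]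
    simp
    omega
  rw [cnt_extend_of_mem hw _ _ _ hv]
  by_cases hvA : v ∈ A
  · have hvB := hdisj hvA
    have hvu : v ≠ u := by rintro rfl; exact huA hvA
    have h1 : deg G B v = 1 := by
      have h0 : deg G (B.erase u) v = 0 := Finset.sum_eq_zero fun z hz => by
        rw [if_neg]
        rw [hAB v hvA z (Finset.mem_of_mem_erase hz)]
        exact Finset.ne_of_mem_erase hz
      rw [deg_erase hu, if_pos ((hAB v hvA u hu).2 rfl), h0]
    rw [cnt_union hd, cnt_const (S := A) (i := 1) (fun z hz => by simp [hz, hvA]),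
      cnt_const (S := B) (i := 0) (fun z hz => by simp [hdisj' hz, hvA]), h1]
    have h2 := hA v hvA
    simp only [(hwA v hvA).symm, true_and, hvu, false_or]
    revert j
    by_cases hva : v = a₀
    · simp only [hva, forall_fin_three, ZOdd] at h2 ⊢
      simp
      omega
    · simp only [hva, forall_fin_three, ZOdd]
      simp
      omega
  · have hvB := (Finset.mem_union.1 hv).resolve_left hvA
    have h1 : ¬ G.Adj v w := fun h => hwB v hvB h.symm
    have hva : v ≠ a₀ := by rintro rfl; exact hvA ha₀
    have h2 : deg G A v = if v = u then A.card else 0 := by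
      split_ifs with hvu
      · rw [Finset.card_eq_sum_ones]
        exact Finset.sum_congr rfl fun z hz => by
          rw [if_pos ((hAB z hz v hvB).2 hvu).symm]
      · exact Finset.sum_eq_zero fun z hz => by
          rw [if_neg fun h => hvu ((hAB z hz v hvB).1 h.symm)]
    rw [cnt_union hd, cnt_const (S := A) (i := 0) (fun z hz => by simp [hz, hvA]),
      cnt_congr (S := B) (χ' := χ) (fun z hz => by simp [hdisj' hz, hvA]), h2]
    obtain ⟨h3, h4⟩ := h v hvB
    simp only [h1, false_and, if_false, zero_add, hva, or_false]
    by_cases hj : j = 0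
    · subst hj
      right
      simp
      split_ifs <;> omega
    · have h5 := h4 j hj
      simp only [Ne.symm hj, if_false, zero_add]
      simpa only [eq_comm (a := j)] using h5

/-- Attaching a set of odd vertices, all adjacent to two given vertices and to no others. -/
lemma Good.union_two {T A : Finset V} {u w : V} (hT : Conn G T) (hd : Disjoint T A) (hu : u ∈ T)
    (hw : w ∈ T) (huw : u ≠ w) (hAT : ∀ a ∈ A, ∀ b ∈ T, G.Adj a b ↔ b = u ∨ b = w)
    (hA : ∀ a ∈ A, deg G A a % 2 = 1) (h : Good G T) : Good G (T ∪ A) := by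
  obtain ⟨χ, e, hχ, he, h⟩ := h
  have hcT : 2 ≤ T.card := Finset.one_lt_card.2 ⟨u, hu, w, hw, huw⟩
  obtain ⟨s, hs, hus⟩ := hT.exists_adj hu hcT
  obtain ⟨t, ht, hwt⟩ := hT.exists_adj hw hcT
  have hcA := sum_deg_parity hA
  have hdisj : ∀ {a}, a ∈ T → a ∉ A := @(Finset.disjoint_left.1 hd)
  have hdisj' : ∀ {a}, a ∈ A → a ∉ T := @(Finset.disjoint_right.1 hd)
  have hpos : ∀ {a b}, b ∈ T → G.Adj a b → cnt G T χ (χ a b) a ≠ 0 := by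
    intro a b hb hab
    rw [cnt_erase hb]
    simp [hab]
  obtain ⟨k, hk⟩ : ∃ k : Fin 3, ∀ n : ℕ, n % 2 = 1 → ∀ j,
      ZOdd ((if χ u s = j then 1 else 0) + (if χ w t = j then 1 else 0) +
        if k = j then n else 0) := by
    generalize χ u s = i
    generalize χ w t = i'
    obtain ⟨k, hk⟩ : ∃ k, (i = i' ∧ k = i) ∨ (i ≠ i' ∧ k ≠ i ∧ k ≠ i') := by
      revert i i'; decide
    refine ⟨k, fun n hn j => ?_⟩
    unfold ZOdd
    rcases hk with ⟨rfl, rfl⟩ | ⟨h1, h2, h3⟩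
    · split_ifs <;> omega
    · have : ¬ (i = j ∧ i' = j) ∧ ¬ (k = j ∧ i = j) ∧ ¬ (k = j ∧ i' = j) := by
        refine ⟨?_, ?_, ?_⟩
        · rintro ⟨rfl, rfl⟩; exact h1 rfl
        · rintro ⟨rfl, rfl⟩; exact h2 rfl
        · rintro ⟨rfl, rfl⟩; exact h3 rfl
      split_ifs <;> omega
  let χ' : V → V → Fin 3 := fun a b => if a ∈ A ∧ b ∈ A then k else
    if a ∈ A ∨ b ∈ A then (if a = u ∨ b = u then χ u s else χ w t) else χ a b
  have hcA' : ∀ v ∈ T, deg G A v = if v = u ∨ v = w then A.card else 0 := by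
    intro v hv
    split_ifs with hvu
    · rw [Finset.card_eq_sum_ones]
      exact Finset.sum_congr rfl fun z hz => by
        rw [if_pos ((hAT z hz v hv).2 hvu).symm]
    · exact Finset.sum_eq_zero fun z hz => by
        rw [if_neg fun h => hvu ((hAT z hz v hv).1 h.symm)]
  refine Good.union (χ' := χ') hd (fun a b => by
      simp only [χ', or_comm, and_comm, hχ a b]) he h (fun a ha b hb => ?_)
    (fun v hv j => ?_) (fun v hv j => ?_)
  · simp [χ', hdisj ha, hdisj hb]
  · have hvA := hdisj hv
    by_cases hvu : v = u
    · subst hvu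
      rw [cnt_const (i := χ v s) (fun z hz => by simp [χ', hz, hvA]), hcA' v hv]
      have := hpos hs hus
      by_cases hj : χ v s = j
      · subst hj; simp [hcA, this]
      · simp [hj]
    by_cases hvw : v = w
    · subst hvw
      rw [cnt_const (i := χ v t) (fun z hz => by
        simp [χ', hz, hvA, hvu, show z ≠ u from fun h => hdisj hu (h ▸ hz)]), hcA' v hv]
      have := hpos ht hwt
      by_cases hj : χ v t = j
      · subst hj; simp [hcA, this]
      · simp [hj]
    · rw [cnt_zero_of_ne]
      · simp
      · intro z hz hvz
        have := (hAT z hz v hv).1 hvz.symm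
        tauto
  · have hvT := hdisj' hv
    have hvu : v ≠ u := fun h => hvT (h ▸ hu)
    rw [cnt_union hd, cnt_const (S := A) (i := k) (fun z hz => by simp [χ', hz, hv]),
      cnt_erase hu, cnt_erase (S := T.erase u) (t := w) (by simp [hw, huw.symm]), cnt_zero_of_ne]
    · have h1 := hk _ (hA v hv) j
      simp only [(hAT v hv u hu).2 (Or.inl rfl), (hAT v hv w hw).2 (Or.inr rfl), χ', hv, hdisj hu,
        hdisj hw, huw.symm, hvu]
      simpa [add_assoc] using h1
    · intro z hz hvz
      have := (hAT v hv z (by grind)).1 hvz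
      grind

lemma deg_eq_one {S : Finset V} {a u : V} (hu : u ∈ S) (h : ∀ z ∈ S, G.Adj a z ↔ z = u) :
    deg G S a = 1 := by
  have h0 : deg G (S.erase u) a = 0 := Finset.sum_eq_zero fun z hz => by
    rw [if_neg]
    rw [h z (Finset.mem_of_mem_erase hz)]
    exact Finset.ne_of_mem_erase hz
  rw [deg_erase hu, if_pos ((h u hu).2 rfl), h0]

/-- An even vertex `w` with a neighbour in an end block of the rest can be dealt with. -/
lemma Good.of_even_vertex {S A : Finset V} {u w : V} (hw : w ∈ S) (hdw : deg G S w % 2 = 0)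
    (hSw : Conn G (S.erase w)) (hatt : Attached G (S.erase w) u A) (hA : Conn G A)
    (hAe : ∀ y ∈ A, Conn G ((S.erase w).erase y)) (hwA : ∃ a ∈ A, G.Adj w a)
    (hc : S.card % 2 = 1) (ih : ∀ T, T ⊂ S → Conn G T → Good G T) : Good G S := by
  have hB := hatt.conn_sdiff hSw
  obtain ⟨hAS, hAne, hu, huA, hAu⟩ := hatt
  have hsplit : ∀ y ∈ A, insert w (insert y ((S.erase w).erase y)) = S ∧
      y ∉ (S.erase w).erase y ∧ w ∉ insert y ((S.erase w).erase y) ∧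
      ((S.erase w).erase y).card % 2 = 1 := by
    intro y hy
    have h1 := hAS hy
    have h2 : insert y ((S.erase w).erase y) = S.erase w := Finset.insert_erase h1
    refine ⟨by rw [h2, Finset.insert_erase hw], by simp, by rw [h2]; simp, ?_⟩
    have h3 := Finset.card_pos.2 ⟨y, h1⟩
    rw [Finset.card_erase_of_mem h1]
    rw [Finset.card_erase_of_mem hw] at h3 ⊢
    omega
  by_cases h1 : ∃ y ∈ A, G.Adj w y ∧ deg G S y % 2 = 0
  · obtain ⟨y, hy, hwy, hdy⟩ := h1
    obtain ⟨e1, e2, e3, e4⟩ := hsplit y hy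
    have := Good.insert_even_even (hAe y hy) e2 e3 hwy (by rwa [e1]) (by rwa [e1]) e4
    rwa [e1] at this
  push Not at h1
  by_cases h2 : ∃ y ∈ A, ¬ G.Adj w y
  · obtain ⟨y₀, hy₀, hwy₀⟩ := h2
    obtain ⟨a₀, ha₀, hwa₀⟩ := hwA
    obtain ⟨a, ha, y, hy, hyA, hay⟩ := hA (A.filter fun z => G.Adj w z) (Finset.filter_subset _ _)
      ⟨a₀, by simp [ha₀, hwa₀]⟩ (by
        intro h
        rw [← h] at hy₀
        exact hwy₀ (Finset.mem_filter.1 hy₀).2)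
    rw [Finset.mem_filter] at ha
    have hwy : ¬ G.Adj w y := fun h => hyA (Finset.mem_filter.2 ⟨hy, h⟩)
    obtain ⟨e1, e2, e3, e4⟩ := hsplit y hy
    have hda : deg G S a % 2 = 1 := by have := h1 a ha.1 ha.2; omega
    have haS := hAS ha.1
    have := Good.insert_common_neighbor (hAe y hy) e2 e3 hwy (a := a)
      (Finset.mem_erase.2 ⟨hay.ne, haS⟩) ha.2 hay.symm (by rwa [e1]) (by rwa [e1]) e4
    rwa [e1] at this
  push Not at h2
  have hodd : ∀ a ∈ A, deg G S a % 2 = 1 := fun a ha => by have := h1 a ha (h2 a ha); omega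
  obtain ⟨B, hBdef⟩ : ∃ B, B = S.erase w \ A := ⟨_, rfl⟩
  rw [← hBdef] at hB
  have hd : Disjoint A B := by rw [hBdef]; exact Finset.disjoint_sdiff
  have hAB : A ∪ B = S.erase w := by rw [hBdef]; exact Finset.union_sdiff_of_subset hAS
  have hBsub : ∀ b ∈ B, b ∈ S.erase w ∧ b ∉ A := by
    intro b hb; rwa [hBdef, Finset.mem_sdiff] at hb
  have huB : u ∈ B := by rw [hBdef]; exact Finset.mem_sdiff.2 ⟨hu, huA⟩
  by_cases h3 : ∃ v ∈ A, ¬ G.Adj v u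
  · obtain ⟨v, hv, hvu⟩ := h3
    obtain ⟨e1, e2, e3, e4⟩ := hsplit v hv
    have e5 : A.erase v ∪ B = (S.erase w).erase v := by
      rw [← hAB, Finset.erase_union_distrib, Finset.erase_eq_of_notMem fun h => (hBsub v h).2 hv]
    have := Good.insert_dominating (G := G) (A := A.erase v) (B := B) (v := v) (w := w)
      (hd.mono_left (Finset.erase_subset _ _)) (by rwa [e5]) (by rwa [e5]) hB (h2 v hv)
      (fun z hz hvz => by
        have hzA : z ∈ A := by
          by_contra hzA
          have hzS : z ∈ S.erase w := by rw [e5] at hz; exact Finset.mem_of_mem_erase hz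
          exact hvu (hAu v hv z hzS hzA hvz ▸ hvz)
        exact ⟨Finset.mem_erase.2 ⟨hvz.ne.symm, hzA⟩, h2 z hzA⟩)
      (by rw [e5, e1]; exact fun a ha => hodd a (Finset.mem_of_mem_erase ha))
      (by rw [e5, e1]; exact hodd v hv) (by rwa [e5, e1]) (by rwa [e5])
    rwa [e5, e1] at this
  push Not at h3
  have hABu : ∀ a ∈ A, ∀ b ∈ B, G.Adj a b ↔ b = u := fun a ha b hb =>
    ⟨hAu a ha b (hBsub b hb).1 (hBsub b hb).2, fun h => h ▸ h3 a ha⟩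
  have hwAB : w ∉ A ∪ B := by rw [hAB]; simp
  have hS : insert w (A ∪ B) = S := by rw [hAB, Finset.insert_erase hw]
  have hdA : ∀ a ∈ A, deg G A a % 2 = 1 := by
    intro a ha
    have h4 := hodd a ha
    rw [← hS, deg_insert hwAB, deg_union hd, deg_eq_one huB (hABu a ha),
      if_pos (h2 a ha).symm] at h4
    omega
  by_cases h4 : ∃ b ∈ B, G.Adj w b
  · obtain ⟨b, hb, hwb⟩ := h4
    have hT : Conn G (insert w B) := hB.insert hb hwb
    have hwA' : w ∉ A := fun h => hwAB (Finset.mem_union_left _ h)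
    have hS' : insert w B ∪ A = S := by
      rw [Finset.insert_union, Finset.union_comm, hS]
    have hd' : Disjoint (insert w B) A := by
      rw [Finset.disjoint_insert_left]
      exact ⟨hwA', hd.symm⟩
    rw [← hS']
    refine Good.union_two hT hd' (Finset.mem_insert_of_mem huB) (Finset.mem_insert_self _ _)
      (fun h => hwAB (h ▸ Finset.mem_union_right _ huB)) (fun a ha b hb => ?_) hdA (ih _ ?_ hT)
    · rcases Finset.mem_insert.1 hb with rfl | hb'
      · simp [(h2 a ha).symm]
      · have : b ≠ w := fun h => hwAB (h ▸ Finset.mem_union_right _ hb')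
        simp [hABu a ha b hb', this]
    · obtain ⟨a, ha⟩ := hAne
      rw [← hS']
      exact ⟨Finset.subset_union_left, fun h =>
        Finset.disjoint_right.1 hd' ha (h (Finset.mem_union_right _ ha))⟩
  · push Not at h4
    rw [← hS]
    refine Good.insert_double_apex hd hwAB hB ?_ huB h2 h4 hABu hdA hAne
    have h5 := sum_deg_parity hdA
    rw [← hS, Finset.card_insert_of_notMem hwAB, Finset.card_union_of_disjoint hd] at hc
    omega

lemma exists_of_deg_pos {S : Finset V} {u : V} (h : 0 < deg G S u) : ∃ z ∈ S, G.Adj u z := by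
  by_contra hcon
  push Not at hcon
  have : deg G S u = 0 := Finset.sum_eq_zero fun z hz => if_neg (hcon z hz)
  omega

/-- A vertex of degree one can be removed. -/
lemma Good.of_leaf {S : Finset V} (hS : Conn G S) (hc : S.card % 2 = 1) {l : V} (hl : l ∈ S)
    (hd : deg G S l = 1) : Good G S := by
  obtain ⟨p, hp, hlp⟩ := exists_of_deg_pos (G := G) (S := S) (u := l) (by omega)
  have hd' := deg_erase (G := G) hp l
  have hatt : Attached G S p {l} := by
    refine ⟨by simpa using hl, by simp, hp, by simpa using hlp.ne.symm, ?_⟩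
    intro a ha b hb hba hab
    rw [Finset.mem_singleton] at ha
    subst ha
    by_contra hbp
    have := deg_pos (Finset.mem_erase.2 ⟨hbp, hb⟩) hab
    rw [if_pos hlp] at hd'
    omega
  have h1 := hatt.conn_sdiff hS
  rw [Finset.sdiff_singleton_eq_erase] at h1
  have h2 := deg_erase (G := G) hl l
  simp only [SimpleGraph.irrefl, if_false] at h2
  have h3 := Finset.card_pos.2 ⟨l, hl⟩
  rw [← Finset.insert_erase hl]
  exact Good.insert_leaf h1 (by rw [Finset.card_erase_of_mem hl]; omega) (by simp) (by omega)

/-- An end block containing an even vertex. -/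
lemma Good.of_even_mem {S C : Finset V} {c w : V} (hmin : ∀ u ∈ S, 2 ≤ deg G S u)
    (hatt : Attached G S c C) (hC : Conn G C) (hCe : ∀ y ∈ C, Conn G (S.erase y)) (hw : w ∈ C)
    (hdw : deg G S w % 2 = 0) (hc : S.card % 2 = 1)
    (ih : ∀ T, T ⊂ S → Conn G T → Good G T) : Good G S := by
  obtain ⟨hCS, -, hcS, hcC, hCc⟩ := hatt
  have hwS := hCS hw
  have hcw : c ≠ w := fun h => hcC (h ▸ hw)
  have hatt' : Attached G (S.erase w) c (C.erase w) := by
    refine ⟨Finset.erase_subset_erase _ hCS, ?_, Finset.mem_erase.2 ⟨hcw, hcS⟩,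
      fun h => hcC (Finset.mem_of_mem_erase h), ?_⟩
    · have h1 := deg_erase (G := G) hcS w
      have h2 := hmin w hwS
      obtain ⟨z, hz, hwz⟩ := exists_of_deg_pos (G := G) (S := S.erase c) (u := w) (by
        split_ifs at h1 <;> omega)
      refine ⟨z, Finset.mem_erase.2 ⟨hwz.ne.symm, ?_⟩⟩
      by_contra hzC
      exact Finset.ne_of_mem_erase hz (hCc w hw z (Finset.mem_of_mem_erase hz) hzC hwz)
    · intro a ha b hb hba hab
      rw [Finset.mem_erase] at ha hb hba
      exact hCc a ha.2 b hb.2 (fun h => hba ⟨hb.1, h⟩) hab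
  obtain ⟨u, A, hAC, hattA, hA, hAe⟩ := hatt'.exists_end (hCe w hw)
  refine Good.of_even_vertex hwS hdw (hCe w hw) hattA hA hAe ?_ hc ih
  obtain ⟨hAS, hAne, hu, huA, hAu⟩ := hattA
  by_contra hcon
  push Not at hcon
  have hcl : ∀ a ∈ A, ∀ b ∈ S, b ∉ A → G.Adj a b → b = u := by
    intro a ha b hb hbA hab
    refine hAu a ha b (Finset.mem_erase.2 ⟨?_, hb⟩) hbA hab
    rintro rfl
    exact hcon a ha hab.symm
  by_cases huC : u ∈ C
  · obtain ⟨a, ha, b, hb, hbA, hab⟩ := hCe u huC A (by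
      intro a ha
      exact Finset.mem_erase.2 ⟨fun h => huA (h ▸ ha), Finset.mem_of_mem_erase (hAS ha)⟩) hAne (by
      rintro rfl
      exact Finset.notMem_erase w C (hAC (Finset.mem_erase.2
        ⟨(Finset.ne_of_mem_erase hu).symm, hwS⟩)))
    exact Finset.ne_of_mem_erase hb (hcl a ha b (Finset.mem_of_mem_erase hb) hbA hab)
  · obtain ⟨a, ha, b, hb, hbA, hab⟩ := hC A (hAC.trans (Finset.erase_subset _ _)) hAne (by
      rintro rfl
      exact Finset.notMem_erase w A (hAC hw))
    exact huC (hcl a ha b (hCS hb) hbA hab ▸ hb)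

/-- An end block all of whose vertices are odd. -/
lemma Good.of_odd_block {S C : Finset V} {c : V} (hS : Conn G S) (hmin : ∀ u ∈ S, 2 ≤ deg G S u)
    (hatt : Attached G S c C) (hC : Conn G C) (hCe : ∀ y ∈ C, Conn G (S.erase y))
    (hodd : ∀ u ∈ C, deg G S u % 2 = 1) (hc : S.card % 2 = 1)
    (ih : ∀ T, T ⊂ S → Conn G T → Good G T) : Good G S := by
  have hT := hatt.conn_sdiff hS
  obtain ⟨hCS, ⟨y₀, hy₀⟩, hcS, hcC, hCc⟩ := hatt
  obtain ⟨T, hTdef⟩ : ∃ T, T = S \ C := ⟨_, rfl⟩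
  rw [← hTdef] at hT
  have hd : Disjoint T C := by rw [hTdef]; exact Finset.sdiff_disjoint
  have hTC : T ∪ C = S := by rw [hTdef]; exact Finset.sdiff_union_of_subset hCS
  have hTS : T ⊆ S := by rw [hTdef]; exact Finset.sdiff_subset
  have hcT : c ∈ T := by rw [hTdef]; exact Finset.mem_sdiff.2 ⟨hcS, hcC⟩
  have hCT : ∀ a ∈ C, ∀ b ∈ T, G.Adj a b → b = c := fun a ha b hb =>
    hCc a ha b (hTS hb) (Finset.disjoint_left.1 hd hb)
  have hzero : ∀ u ∈ T, u ≠ c → deg G C u = 0 := fun u hu huc =>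
    Finset.sum_eq_zero fun z hz => if_neg fun h => huc (hCT z hz u hu h.symm)
  have hdeg : ∀ u, deg G S u = deg G T u + deg G C u := fun u => by rw [← hTC, deg_union hd]
  have hpar : deg G C c % 2 = C.card % 2 := by
    have h1 : (∑ u ∈ C, (deg G T u + deg G C u)) % 2 = C.card % 2 := by
      simp only [← hdeg]
      rw [Finset.sum_nat_mod, Finset.sum_congr rfl hodd]; simp
    have h2 := sum_deg_even (G := G) C
    have h3 : ∑ u ∈ T, deg G C u = deg G C c := Finset.sum_eq_single_of_mem c hcT hzero
    rw [Finset.sum_add_distrib, sum_deg_comm, h3] at h1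
    omega
  rcases Nat.mod_two_eq_zero_or_one C.card with hcC2 | hcC2
  · by_cases hT2 : 2 ≤ T.card
    · obtain ⟨t, ht, hct⟩ := hT.exists_adj hcT hT2
      obtain ⟨χ, e, hχ, he, h⟩ := ih T
        ⟨hTS, fun h => Finset.disjoint_right.1 hd hy₀ (h (hCS hy₀))⟩ hT
      rw [← hTC] at hodd ⊢
      refine Good.union_const hd hχ he h (χ c t) (fun u hu => ?_) hodd
      by_cases huc : u = c
      · subst huc
        refine ⟨by omega, fun _ => ?_⟩
        rw [cnt_erase ht]
        simp [hct]
      · simp [hzero u hu huc]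
    · have hT1 : T = {c} := by
        have := Finset.card_pos.2 ⟨c, hcT⟩
        obtain ⟨x, hx⟩ := Finset.card_eq_one.1 (show T.card = 1 by omega)
        rw [hx] at hcT ⊢
        rw [Finset.mem_singleton.1 hcT]
      have hSC : S.erase c = C := by
        rw [← hTC, hT1, ← Finset.insert_eq, Finset.erase_insert hcC]
      have hC2 : 2 ≤ C.card := by have := Finset.card_pos.2 ⟨y₀, hy₀⟩; omega
      obtain ⟨u, A, hAC, hattA, hA, hAe⟩ := (Conn.attached_erase (G := G) hy₀ hC2).exists_end hC
      have hdc : deg G S c % 2 = 0 := by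
        have h1 : deg G T c = 0 := by rw [hT1]; simp [deg]
        have := hdeg c
        omega
      refine Good.of_even_vertex hcS hdc (by rwa [hSC]) (by rwa [hSC]) hA (by rwa [hSC]) ?_ hc ih
      obtain ⟨hAS, hAne, hu, huA, hAu⟩ := hattA
      by_contra hcon
      push Not at hcon
      have huc : u ≠ c := fun h => hcC (h ▸ hu)
      obtain ⟨a, ha, b, hb, hbA, hab⟩ := hCe u hu A (by
        intro a ha
        exact Finset.mem_erase.2 ⟨fun h => huA (h ▸ ha), hCS (hAS ha)⟩) hAne (by
        rintro rfl
        exact hcC (hAS (Finset.mem_erase.2 ⟨huc.symm, hcS⟩)))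
      rw [Finset.mem_erase] at hb
      have hbc : b ≠ c := by
        rintro rfl
        exact hcon a ha hab.symm
      exact hb.1 (hAu a ha b (hSC ▸ Finset.mem_erase.2 ⟨hbc, hb.2⟩) hbA hab)
  · obtain ⟨y, hy, hcy⟩ := exists_of_deg_pos (G := G) (S := C) (u := c) (by omega)
    have hyT : y ∉ T := Finset.disjoint_right.1 hd hy
    have hT' : Conn G (insert y T) := hT.insert hcT hcy.symm
    have hd' : Disjoint (insert y T) (C.erase y) := by
      rw [Finset.disjoint_insert_left]
      exact ⟨by simp, hd.mono_right (Finset.erase_subset _ _)⟩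
    have hS' : insert y T ∪ C.erase y = S := by
      rw [← hTC, Finset.insert_union, ← Finset.union_insert, Finset.insert_erase hy]
    have hyT1 : deg G T y = 1 := deg_eq_one hcT fun z hz =>
      ⟨hCT y hy z hz, fun h => h ▸ hcy.symm⟩
    have hss : insert y T ⊂ S := by
      refine ⟨by rw [← hS']; exact Finset.subset_union_left, fun h => ?_⟩
      have h1 := hmin y (hCS hy)
      have h2 := hdeg y
      obtain ⟨z, hz, hyz⟩ := exists_of_deg_pos (G := G) (S := C) (u := y) (by omega)
      rcases Finset.mem_insert.1 (h (hCS hz)) with rfl | h3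
      · exact G.irrefl hyz
      · exact Finset.disjoint_left.1 hd h3 hz
    obtain ⟨χ, e, hχ, he, h⟩ := ih _ hss hT'
    have hodd' : ∀ u ∈ C.erase y, deg G (insert y T ∪ C.erase y) u % 2 = 1 := fun u hu => by
      rw [hS']; exact hodd u (Finset.mem_of_mem_erase hu)
    rw [← hS']
    refine Good.union_const hd' hχ he h (χ c y) (fun u hu => ?_) hodd'
    have h1 := deg_erase (G := G) hy u
    rcases Finset.mem_insert.1 hu with rfl | hu
    · rw [if_neg G.irrefl] at h1
      have h2 := hodd u hy
      rw [hdeg, hyT1] at h2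
      refine ⟨by omega, fun _ => ?_⟩
      rw [cnt_erase (Finset.mem_insert_of_mem hcT)]
      simp [hcy.symm, hχ u c]
    by_cases huc : u = c
    · subst huc
      rw [if_pos hcy] at h1
      refine ⟨by omega, fun _ => ?_⟩
      rw [cnt_erase (Finset.mem_insert_self _ _)]
      simp [hcy]
    · have h2 := hzero u hu huc
      have h3 : deg G (C.erase y) u = 0 := by omega
      simp [h3]

theorem Good.of_conn {S : Finset V} (hS : Conn G S) : Good G S := by
  induction S using Finset.strongInduction with
  | H S ih =>
  rcases Nat.mod_two_eq_zero_or_one S.card with hc | hc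
  · exact Good.of_even hS hc
  by_cases hc1 : S.card = 1
  · obtain ⟨v, rfl⟩ := Finset.card_eq_one.1 hc1
    refine Good.of_coloring (χ := fun _ _ => 0) (fun _ _ => rfl) fun u hu j => Or.inl ?_
    rw [Finset.mem_singleton.1 hu]
    simp [cnt]
  have hc2 : 2 ≤ S.card := by omega
  by_cases hleaf : ∃ l ∈ S, deg G S l = 1
  · obtain ⟨l, hl, hd⟩ := hleaf
    exact Good.of_leaf hS hc hl hd
  push Not at hleaf
  have hmin : ∀ u ∈ S, 2 ≤ deg G S u := by
    intro u hu
    obtain ⟨t, ht, hut⟩ := hS.exists_adj hu hc2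
    have := deg_pos ht hut
    have := hleaf u hu
    omega
  obtain ⟨c₀, hc₀⟩ := Finset.card_pos.1 (show 0 < S.card by omega)
  obtain ⟨c, C, -, hatt, hC, hCe⟩ := (Conn.attached_erase (G := G) hc₀ hc2).exists_end hS
  by_cases hev : ∃ w ∈ C, deg G S w % 2 = 0
  · obtain ⟨w, hw, hdw⟩ := hev
    exact Good.of_even_mem hmin hatt hC hCe hw hdw hc ih
  · push Not at hev
    exact Good.of_odd_block hS hmin hatt hC hCe (fun u hu => by have := hev u hu; omega) hc ih

lemma conn_univ [Fintype V] (hG : G.Connected) : Conn G Finset.univ := by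
  rintro A - ⟨a, ha⟩ hA
  obtain ⟨b, hb⟩ : ∃ b, b ∉ A := by
    by_contra h
    push Not at h
    exact hA (Finset.eq_univ_of_forall h)
  obtain ⟨p⟩ := hG.preconnected a b
  obtain ⟨d, -, h1, h2⟩ := p.exists_boundary_dart (A : Set V) ha hb
  exact ⟨d.fst, h1, d.snd, Finset.mem_univ _, h2, d.adj⟩

lemma ncard_incident [Fintype V] (ψ : Sym2 V → Finset (Fin 3)) (j : Fin 3) (v : V) :
    {e | e ∈ G.edgeSet ∧ j ∈ ψ e ∧ v ∈ e}.ncard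
      = ∑ z : V, if G.Adj v z ∧ j ∈ ψ s(v, z) then 1 else 0 := by
  have h : {e | e ∈ G.edgeSet ∧ j ∈ ψ e ∧ v ∈ e}
      = Set.image (fun z => s(v, z)) {z | G.Adj v z ∧ j ∈ ψ s(v, z)} := by
    ext e
    constructor
    · rintro ⟨h1, h2, z, rfl⟩
      exact ⟨z, ⟨h1, h2⟩, rfl⟩
    · rintro ⟨z, ⟨h1, h2⟩, rfl⟩
      exact ⟨h1, h2, Sym2.mem_mk_left _ _⟩
  rw [h, Set.ncard_image_of_injective _ (fun a b hab => Sym2.congr_right.1 hab),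
    ← Finset.card_filter, ← Set.ncard_coe_finset]
  simp

end OddCover

/-- For every connected simple graph `G` there is an assignment of nonempty subsets of
`{1,2,3}` to the edges such that each color class induces a subgraph with all
non-isolated vertices of odd degree, and the total overlap is at most 2 (i.e. at most
one edge receives more than one color, and it receives exactly two). -/
theorem stmt_12 {V : Type*} [Fintype V] [DecidableEq V] (G : SimpleGraph V)
    [DecidableRel G.Adj] (hG : G.Connected) :
    ∃ ψ : Sym2 V → Finset (Fin 3),
      (∀ e ∈ G.edgeSet, (ψ e).Nonempty) ∧
      (∀ (j : Fin 3) (v : V),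
        {e | e ∈ G.edgeSet ∧ j ∈ ψ e ∧ v ∈ e}.ncard = 0 ∨
          Odd {e | e ∈ G.edgeSet ∧ j ∈ ψ e ∧ v ∈ e}.ncard) ∧
      (∑ e ∈ G.edgeFinset, (if 2 ≤ (ψ e).card then (ψ e).card else 0)) ≤ 2 := by
  obtain ⟨χ, e, hχ, he, h⟩ := OddCover.Good.of_conn (OddCover.conn_univ hG)
  simp only [OddCover.ncard_incident, Nat.odd_iff]
  rcases he with he | ⟨p, -, q, -, k, hpq, hk, he⟩
  · refine ⟨fun s => {Sym2.lift ⟨χ, hχ⟩ s}, by simp, fun j v => ?_, by simp⟩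
    have := h v (Finset.mem_univ v) j
    rw [he] at this
    simpa [OddCover.ZOdd, OddCover.cnt, eq_comm (a := j)] using this
  · refine ⟨fun s => if s = s(p, q) then {χ p q, k} else {Sym2.lift ⟨χ, hχ⟩ s}, fun s _ => ?_,
      fun j v => ?_, ?_⟩
    · dsimp only
      split_ifs <;> simp
    · have h1 := h v (Finset.mem_univ v) j
      have h2 : e v j = ∑ z : V, if s(v, z) = s(p, q) ∧ j = k then 1 else 0 := by
        rw [he]
        by_cases hj : j = k
        · have hne := hpq.ne
          by_cases hvp : v = p
          · subst hvp; simp [hj, hne]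
          · by_cases hvq : v = q
            · subst hvq; simp [hj, hvp]
            · simp [hvp, hvq]
        · simp [hj]
      rw [h2, OddCover.cnt, ← Finset.sum_add_distrib] at h1
      have h3 : ∀ z, (if G.Adj v z ∧ j ∈ (if s(v, z) = s(p, q) then ({χ p q, k} : Finset (Fin 3))
          else {Sym2.lift ⟨χ, hχ⟩ s(v, z)}) then 1 else 0) =
            (if G.Adj v z ∧ χ v z = j then 1 else 0) + if s(v, z) = s(p, q) ∧ j = k then 1 else 0 := by
        intro z
        by_cases hz : s(v, z) = s(p, q)
        · have hvz : G.Adj v z := by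
            rw [← SimpleGraph.mem_edgeSet, hz]; exact hpq
          have hχz : χ v z = χ p q := by
            rcases Sym2.eq_iff.1 hz with ⟨rfl, rfl⟩ | ⟨rfl, rfl⟩
            · rfl
            · exact hχ _ _
          simp only [hz, hvz, hχz, if_true, true_and, Finset.mem_insert, Finset.mem_singleton]
          by_cases hj : j = k
          · subst hj; simp [hk]
          · simp [hj, eq_comm (a := j)]
        · simp [hz, eq_comm (a := j)]
      simp only [h3]
      exact h1
    · refine (Finset.sum_le_univ_sum_of_nonneg fun _ => Nat.zero_le _).trans ?_
      rw [Finset.sum_eq_single s(p, q)]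
      · split_ifs
        · simpa using Finset.card_le_two
        · simp
      · intro s _ hs
        simp [hs]
      · simp
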